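/- Under condition [A], the strong law of large numbers holds for the chain with unbounded variable length memory: R(n)/n → a almost surely as n → ∞, where a := E[ζ]/E[τ]. -/

import Mathlib

noncomputable section

/-- A chain with unbounded variable length memory over the binary alphabet `{0,1}`,
with memory parameter `v ≥ 1`.  For `k ∈ ℕ ∪ {0}` (the distance from the current
position to the nearest `1`) and a word `w` of `v - 1` letters (the letters standing
to the left of that `1`), `p k w` is the probability of appending the character `1`.
The structure records the sample space, the appended characters `X n = r_n(n)`,
the full configuration `cfg`, the position `mpos ω n` of the rightmost `1` among the
coordinates `≤ n`, and the Markov transition rule `htrans`. -/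
structure VLMC (v : ℕ) (p : ℕ → (Fin (v - 1) → Bool) → ℝ) where
  /-- the sample space -/
  Ω : Type
  [mΩ : MeasurableSpace Ω]
  /-- the underlying probability measure -/
  P : MeasureTheory.Measure Ω
  hprob : MeasureTheory.IsProbabilityMeasure P
  hv : 0 < v
  /-- the (fixed) initial configuration; only the coordinates `i ≤ 0` are relevant -/
  r0 : ℤ → Bool
  /-- `X n` is the random character appended at step `n`, for `n ≥ 1` -/
  X : ℕ → Ω → Bool
  hXmeas : ∀ n, Measurable (X n)
  /-- the full configuration (it does not change in time: at time `n` only the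
  coordinates `≤ n` are relevant) -/
  cfg : Ω → ℤ → Bool
  hcfg : ∀ ω i, cfg ω i = if i ≤ 0 then r0 i else X i.toNat ω
  /-- `mpos ω n` is the position of the rightmost `1` among the coordinates `≤ n` -/
  mpos : Ω → ℕ → ℤ
  hmpos : ∀ ω n, mpos ω n ≤ (n : ℤ) ∧ cfg ω (mpos ω n) = true ∧
    ∀ i : ℤ, mpos ω n < i → i ≤ (n : ℤ) → cfg ω i = false
  /-- the transition rule: on any cylinder (in the appended characters) on which the
  distance from `n` to the nearest `1` equals `k` and the word of the `v - 1` letters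
  standing to the left of that `1` equals `w`, the conditional probability that the
  character appended at step `n + 1` equals `1` is `p k w`. -/
  htrans : ∀ (n : ℕ) (b : Fin n → Bool) (k : ℕ) (w : Fin (v - 1) → Bool),
    (∀ ω, (∀ i : Fin n, X (i.1 + 1) ω = b i) →
      ((n : ℤ) - mpos ω n = (k : ℤ) ∧
        ∀ j : Fin (v - 1), cfg ω (mpos ω n - ((v : ℤ) - 1) + (j.1 : ℤ)) = w j)) →
    P {ω | (∀ i : Fin n, X (i.1 + 1) ω = b i) ∧ X (n + 1) ω = true}
      = ENNReal.ofReal (p k w) * P {ω | ∀ i : Fin n, X (i.1 + 1) ω = b i}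

open MeasureTheory Filter

namespace VLMC

variable {v : ℕ} {p : ℕ → (Fin (v - 1) → Bool) → ℝ}

/-- Condition [A]: the initial configuration contains at least one `1`, and all the
transition probabilities lie between `δ2` and `δ1`, where `0 < δ2 < δ1 < 1`. -/
def CondA (S : VLMC v p) (δ1 δ2 : ℝ) : Prop :=
  (∃ i : ℤ, i ≤ 0 ∧ S.r0 i = true) ∧
  0 < δ2 ∧ δ2 < δ1 ∧ δ1 < 1 ∧
  ∀ (k : ℕ) (w : Fin (v - 1) → Bool), δ2 ≤ p k w ∧ p k w ≤ δ1

/-- `R n`, the number of `1`s appended during the first `n` steps -/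
def R (S : VLMC v p) (n : ℕ) (ω : S.Ω) : ℕ :=
  ∑ k ∈ Finset.Icc 1 n, (S.X k ω).toNat

/-- `Y(n) = y₀ = (0,(0,…,0,1))`, i.e. the character at position `n` is `1` and the
`v - 1` letters to its left are all `0` -/
def hitY0 (S : VLMC v p) (ω : S.Ω) (n : ℕ) : Prop :=
  S.mpos ω n = (n : ℤ) ∧
    ∀ j : Fin (v - 1), S.cfg ω ((n : ℤ) - ((v : ℤ) - 1) + (j.1 : ℤ)) = false

/-- `T k`, the time of the `k`-th visit of the chain `Y` to the state `y₀`
(`T 0 = 0`) -/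
def T (S : VLMC v p) : ℕ → S.Ω → ℕ
  | 0, _ => 0
  | k + 1, ω => sInf {n | T S k ω < n ∧ S.hitY0 ω n}

/-- `τ_k = T_k - T_{k-1}`, the spacings between consecutive visits to `y₀` -/
def tau (S : VLMC v p) (k : ℕ) (ω : S.Ω) : ℕ := S.T k ω - S.T (k - 1) ω

/-- `ζ_k`, the number of `1`s appended at the times `n ∈ (T_{k-1}, T_k]` -/
def zeta (S : VLMC v p) (k : ℕ) (ω : S.Ω) : ℕ :=
  ∑ n ∈ Finset.Ioc (S.T (k - 1) ω) (S.T k ω), (S.X n ω).toNat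

/-- `ν(n) = max {k ≥ 0 : T_k < n}` -/
def nu (S : VLMC v p) (n : ℕ) (ω : S.Ω) : ℕ := sSup {k | S.T k ω < n}

/-- the generalized renewal process `Z(n) = Σ_{k=0}^{ν(n)} ζ_k` (with `ζ_0 = 0`) -/
def Z (S : VLMC v p) (n : ℕ) (ω : S.Ω) : ℕ :=
  ∑ k ∈ Finset.range (S.nu n ω + 1), S.zeta k ω

/-- `a = E ζ / E τ`, where `(τ, ζ) = (τ_2, ζ_2)` has the common distribution of the
regeneration vectors `ξ_k = (τ_k, ζ_k)`, `k ≥ 2` -/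
def a (S : VLMC v p) : ℝ :=
  (∫ ω, (S.zeta 2 ω : ℝ) ∂S.P) / (∫ ω, (S.tau 2 ω : ℝ) ∂S.P)

/-- `σ² = E (ζ - aτ)² / E τ` -/
def sigma2 (S : VLMC v p) : ℝ :=
  (∫ ω, ((S.zeta 2 ω : ℝ) - S.a * (S.tau 2 ω : ℝ)) ^ 2 ∂S.P) /
    (∫ ω, (S.tau 2 ω : ℝ) ∂S.P)

/-- `ψ(λ,μ) = E e^{λτ + μζ}` (as an extended nonnegative real number) -/
def psi (S : VLMC v p) (l m : ℝ) : ENNReal :=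
  ∫⁻ ω, ENNReal.ofReal (Real.exp (l * S.tau 2 ω + m * S.zeta 2 ω)) ∂S.P

/-- `ψ₁(λ,μ) = E e^{λτ₁ + μζ₁}` -/
def psi1 (S : VLMC v p) (l m : ℝ) : ℝ :=
  ∫ ω, Real.exp (l * S.tau 1 ω + m * S.zeta 1 ω) ∂S.P

/-- the deviation function `D(θ,α) = sup {λθ + μα : A(λ,μ) ≤ 0}` where `A = ln ψ`,
so that `A(λ,μ) ≤ 0 ↔ ψ(λ,μ) ≤ 1` -/
def D2 (S : VLMC v p) (θ α : ℝ) : ℝ :=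
  sSup {x | ∃ l m : ℝ, S.psi l m ≤ 1 ∧ x = l * θ + m * α}

/-- `D(α) = D(1,α)` -/
def D (S : VLMC v p) (α : ℝ) : ℝ := S.D2 1 α

/-- the chain starts from the state `y₀ = (0,(0,…,0,1))`, i.e. `Y(0) = y₀`: the
initial configuration has a `1` at position `0` preceded by `v - 1` zeros -/
def StartsAtY0 (S : VLMC v p) : Prop :=
  S.r0 0 = true ∧ ∀ i : ℤ, 1 - (v : ℤ) ≤ i → i < 0 → S.r0 i = false

end VLMC

namespace VLMC

open ProbabilityTheory

section Sequences

/-- The first `m` letters of `u` end with the block `0^{v-1} 1`. -/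
def EndsPattern (v : ℕ) (u : ℕ → Bool) (m : ℕ) : Prop :=
  v ≤ m ∧ u (m - 1) = true ∧ ∀ j, m ≤ j + v → j + 1 < m → u j = false

/-- The length of the shortest prefix of `u` ending with the block `0^{v-1} 1`. -/
def cycleLength (v : ℕ) (u : ℕ → Bool) : ℕ := sInf {m | EndsPattern v u m}

/-- The number of ones among the first `n` letters of `u`. -/
def ones (u : ℕ → Bool) (n : ℕ) : ℕ := ∑ i ∈ Finset.range n, (u i).toNat

/-- The number of ones in the first cycle of `u`. -/
def cycleOnes (v : ℕ) (u : ℕ → Bool) : ℕ := ones u (cycleLength v u)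

/-- The sequence `u` with its first cycle removed. -/
def cycleShift (v : ℕ) (u : ℕ → Bool) : ℕ → Bool := fun i => u (cycleLength v u + i)

theorem endsPattern_cycleLength {v : ℕ} {u : ℕ → Bool} (h : 0 < cycleLength v u) :
    EndsPattern v u (cycleLength v u) :=
  Nat.sInf_mem (Nat.nonempty_of_pos_sInf h)

theorem cycleLength_pos {v : ℕ} (hv : 0 < v) {u : ℕ → Bool} {m : ℕ} (h : EndsPattern v u m) :
    0 < cycleLength v u :=
  hv.trans_le (Nat.sInf_mem (s := {m | EndsPattern v u m}) ⟨m, h⟩).1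

theorem EndsPattern.congr {v : ℕ} (hv : 0 < v) {u u' : ℕ → Bool} {m : ℕ}
    (huu' : ∀ i < m, u i = u' i) (h : EndsPattern v u m) : EndsPattern v u' m := by
  obtain ⟨h1, h2, h3⟩ := h
  refine ⟨h1, ?_, fun j hj hj' => ?_⟩
  · rw [← huu' _ (by omega), h2]
  · rw [← huu' _ (by omega), h3 j hj hj']

theorem cycleLength_congr {v : ℕ} (hv : 0 < v) {u u' : ℕ → Bool} (hpos : 0 < cycleLength v u)
    (huu' : ∀ i < cycleLength v u, u i = u' i) : cycleLength v u' = cycleLength v u := by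
  have h := (endsPattern_cycleLength hpos).congr hv huu'
  have hle : cycleLength v u' ≤ cycleLength v u := Nat.sInf_le h
  refine le_antisymm hle (Nat.sInf_le ?_)
  exact (endsPattern_cycleLength (cycleLength_pos hv h)).congr hv
    fun i hi => (huu' i (hi.trans_le hle)).symm

theorem cycleOnes_congr {v : ℕ} (hv : 0 < v) {u u' : ℕ → Bool} (hpos : 0 < cycleLength v u)
    (huu' : ∀ i < cycleLength v u, u i = u' i) : cycleOnes v u' = cycleOnes v u := by
  unfold cycleOnes ones
  rw [cycleLength_congr hv hpos huu']
  exact Finset.sum_congr rfl fun i hi => by rw [huu' i (Finset.mem_range.1 hi)]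

theorem cycleOnes_le (v : ℕ) (u : ℕ → Bool) : cycleOnes v u ≤ cycleLength v u := by
  refine (Finset.sum_le_card_nsmul (Finset.range (cycleLength v u)) (fun i => (u i).toNat) 1
    fun i _ => Bool.toNat_le _).trans ?_
  simp

theorem ones_add (u : ℕ → Bool) (m n : ℕ) :
    ones u (m + n) = ones u m + ones (fun i => u (m + i)) n :=
  Finset.sum_range_add _ m n

theorem cycleShift_iterate (v : ℕ) (u : ℕ → Bool) (k : ℕ) :
    (cycleShift v)^[k] u =
      fun i => u (∑ j ∈ Finset.range k, cycleLength v ((cycleShift v)^[j] u) + i) := by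
  induction k with
  | zero => simp
  | succ k ih =>
    rw [Function.iterate_succ_apply', Finset.sum_range_succ]
    funext i
    rw [add_assoc]
    exact congrFun ih _

theorem ones_sum_cycleLength (v : ℕ) (u : ℕ → Bool) (k : ℕ) :
    ones u (∑ j ∈ Finset.range k, cycleLength v ((cycleShift v)^[j] u)) =
      ∑ j ∈ Finset.range k, cycleOnes v ((cycleShift v)^[j] u) := by
  induction k with
  | zero => simp [ones]
  | succ k ih =>
    rw [Finset.sum_range_succ, Finset.sum_range_succ, ones_add, ih, ← cycleShift_iterate]
    rfl

/-- If the average cycle length and the average number of ones per cycle converge, then so does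
the density of ones. -/
theorem tendsto_ones_div {v : ℕ} {u : ℕ → Bool} {α β : ℝ} (hα : 0 < α)
    (hlen : Tendsto (fun n : ℕ => (∑ i ∈ Finset.range n,
      (cycleLength v ((cycleShift v)^[i] u) : ℝ)) / n) atTop (nhds α))
    (hones : Tendsto (fun n : ℕ => (∑ i ∈ Finset.range n,
      (cycleOnes v ((cycleShift v)^[i] u) : ℝ)) / n) atTop (nhds β)) :
    Tendsto (fun n : ℕ => (ones u n : ℝ) / n) atTop (nhds (β / α)) := by
  set t : ℕ → ℕ := fun k => ∑ j ∈ Finset.range k, cycleLength v ((cycleShift v)^[j] u) with ht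
  have hlen' : Tendsto (fun n : ℕ => (t n : ℝ) / n) atTop (nhds α) := by
    simpa [ht] using hlen
  have htop : Tendsto (fun n => (t n : ℝ)) atTop atTop := by
    have := hlen'.pos_mul_atTop hα tendsto_natCast_atTop_atTop
    refine this.congr' ?_
    filter_upwards [eventually_gt_atTop 0] with n hn
    field_simp
  have hpos : ∀ᶠ n in atTop, (0 : ℝ) < t n := htop.eventually_gt_atTop 0
  refine tendsto_div_of_monotone_of_exists_subseq_tendsto_div (fun n => (ones u n : ℝ)) _ ?_ ?_
  · intro m n hmn
    obtain ⟨k, rfl⟩ := Nat.exists_eq_add_of_le hmn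
    simp only [ones_add]
    push_cast
    linarith [(Nat.cast_nonneg (ones (fun i => u (m + i)) k) : (0 : ℝ) ≤ _)]
  · intro a ha
    refine ⟨t, ?_, tendsto_natCast_atTop_iff.1 htop, ?_⟩
    · have h1 : Tendsto (fun n : ℕ => (t (n + 1) : ℝ) / ((n + 1 : ℕ) : ℝ)) atTop (nhds α) :=
        hlen'.comp (tendsto_add_atTop_nat 1)
      have h2 : Tendsto (fun n : ℕ => ((n : ℝ) + 1) / n) atTop (nhds 1) := by
        have := (tendsto_const_nhds (x := (1 : ℝ))).add
          (tendsto_one_div_atTop_nhds_zero_nat (𝕜 := ℝ))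
        rw [add_zero] at this
        refine this.congr' ?_
        filter_upwards [eventually_gt_atTop 0] with n hn
        field_simp
      have h3 := (h1.mul h2).div hlen' hα.ne'
      rw [mul_one, div_self hα.ne'] at h3
      filter_upwards [h3.eventually_lt_const ha, hpos, eventually_gt_atTop 0] with n hn htn hn0
      rw [← div_le_iff₀ htn]
      refine le_of_eq_of_le ?_ hn.le
      have : (0 : ℝ) < n := by exact_mod_cast hn0
      simp only [Pi.div_apply]
      push_cast
      field_simp
    · refine (hones.div hlen' hα.ne').congr' ?_
      filter_upwards [eventually_gt_atTop 0, hpos] with n hn htn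
      have : (0 : ℝ) < n := by exact_mod_cast hn
      simp only [Pi.div_apply, ht, ones_sum_cycleLength]
      push_cast
      field_simp

theorem measurable_sInf_setOf {α : Type*} [MeasurableSpace α] {q : α → ℕ → Prop}
    (hq : ∀ n, MeasurableSet {x | q x n}) : Measurable fun x => sInf {n | q x n} := by
  classical
  refine measurable_to_countable' fun n => ?_
  have hmin : MeasurableSet {x | q x n ∧ ∀ j < n, ¬ q x j} := by
    simp only [Set.ofPred_and, Set.ofPred_forall]
    exact (hq n).inter (.iInter fun j => .iInter fun _ => (hq j).compl)
  have hnone : MeasurableSet {x | n = 0 ∧ ∀ j, ¬ q x j} := by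
    simp only [Set.ofPred_and, Set.ofPred_forall]
    exact (MeasurableSet.const _).inter (.iInter fun j => (hq j).compl)
  convert hmin.union hnone using 1
  ext x
  simp only [Set.mem_preimage, Set.mem_singleton_iff, Set.mem_union, Set.mem_ofPred_eq]
  constructor
  · rintro rfl
    by_cases h : {n | q x n}.Nonempty
    · exact Or.inl ⟨Nat.sInf_mem h, fun j hj => Nat.notMem_of_lt_sInf hj⟩
    · rw [Set.not_nonempty_iff_eq_empty] at h
      refine Or.inr ⟨by simp [h], fun j hj => ?_⟩
      have : j ∈ {n | q x n} := hj
      simp [h] at this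
  · rintro (⟨h, h'⟩ | ⟨rfl, h⟩)
    · refine le_antisymm (Nat.sInf_le h) (not_lt.1 fun hlt => ?_)
      exact h' _ hlt (Nat.sInf_mem (s := {n | q x n}) ⟨n, h⟩)
    · simp [h]

theorem measurable_cycleLength (v : ℕ) : Measurable (cycleLength v) := by
  refine measurable_sInf_setOf fun m => ?_
  unfold EndsPattern
  have hc : ∀ (j : ℕ) (b : Bool), MeasurableSet {u : ℕ → Bool | u j = b} := fun j b =>
    measurableSet_eq_fun (measurable_pi_apply j) measurable_const
  simp only [Set.ofPred_and, Set.ofPred_forall]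
  exact (MeasurableSet.const _).inter ((hc _ _).inter
    (.iInter fun j => .iInter fun _ => .iInter fun _ => hc _ _))

theorem measurable_cycleOnes (v : ℕ) : Measurable (cycleOnes v) := by
  have h : Measurable fun x : ℕ × (ℕ → Bool) => ones x.2 x.1 :=
    measurable_from_prod_countable_right fun n =>
      Finset.measurable_fun_sum (Finset.range n) fun i _ =>
        (measurable_of_countable Bool.toNat).comp (measurable_pi_apply i)
  exact h.comp ((measurable_cycleLength v).prodMk measurable_id)

theorem measurable_cycleShift (v : ℕ) : Measurable (cycleShift v) := by
  refine measurable_pi_lambda _ fun i => ?_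
  have h : Measurable fun x : ℕ × (ℕ → Bool) => x.2 (x.1 + i) :=
    measurable_from_prod_countable_right fun n => measurable_pi_apply (n + i)
  exact h.comp ((measurable_cycleLength v).prodMk measurable_id)

/-- Two finite measures on binary sequences agreeing on all cylinders are equal. -/
theorem measure_ext_of_cylinder {μ ν : Measure (ℕ → Bool)} [IsFiniteMeasure μ] [IsFiniteMeasure ν]
    (h : ∀ (m : ℕ) (u : ℕ → Bool), μ {x | ∀ i < m, x i = u i} = ν {x | ∀ i < m, x i = u i}) :
    μ = ν := by
  refine IsProjectiveLimit.unique (P := fun I => ν.map I.restrict) (fun I => ?_) fun I => rfl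
  obtain ⟨m, hm⟩ : ∃ m, I ⊆ Finset.range m := I.exists_nat_subset_range
  have key : μ.map (Finset.range m).restrict = ν.map (Finset.range m).restrict := by
    refine Measure.ext_iff_singleton.2 fun b => ?_
    rw [Measure.map_apply (Finset.measurable_restrict _) (measurableSet_singleton _),
      Measure.map_apply (Finset.measurable_restrict _) (measurableSet_singleton _)]
    have : (Finset.range m).restrict (π := fun _ => Bool) ⁻¹' {b} =
        {x : ℕ → Bool | ∀ i < m, x i = if hi : i ∈ Finset.range m then b ⟨i, hi⟩ else true} := by
      ext x
      simp only [Set.mem_preimage, Set.mem_singleton_iff, funext_iff, Subtype.forall,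
        Finset.restrict, Set.mem_ofPred_eq, Finset.mem_range]
      refine forall_congr' fun i => forall_congr' fun hi => ?_
      rw [dif_pos hi]
    rw [this]
    exact h m _
  rw [← Finset.restrict₂_comp_restrict hm,
    ← Measure.map_map (Finset.measurable_restrict₂ hm) (Finset.measurable_restrict _), key,
    Measure.map_map (Finset.measurable_restrict₂ hm) (Finset.measurable_restrict _)]
  rfl

theorem measure_eq_tsum_inter_fiber {α : Type*} [MeasurableSpace α] (μ : Measure α) {f : α → ℕ}
    (hf : Measurable f) (E : Set α) : μ E = ∑' n, μ (E ∩ f ⁻¹' {n}) := by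
  have h := tsum_measure_preimage_singleton (μ := μ.restrict E) (s := Set.univ) Set.countable_univ
    (f := f) fun y _ => hf (measurableSet_singleton y)
  rw [Set.preimage_univ, Measure.restrict_apply_univ] at h
  rw [← h, ← tsum_univ (fun n => μ (E ∩ f ⁻¹' {n}))]
  refine tsum_congr fun n => ?_
  rw [Measure.restrict_apply (hf (measurableSet_singleton _)), Set.inter_comm]

/-- The event `D` is determined by the first cycle. -/
def CycleDetermined (v : ℕ) (D : Set (ℕ → Bool)) : Prop :=
  ∀ u u' : ℕ → Bool, 0 < cycleLength v u → (∀ i < cycleLength v u, u i = u' i) → u ∈ D → u' ∈ D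

/-- A law of binary sequences which is regenerative: the shifted sequence is
independent of the first cycle and has the same law. -/
def Regenerative (v : ℕ) (Q : Measure (ℕ → Bool)) : Prop :=
  ∀ D B : Set (ℕ → Bool), MeasurableSet D → MeasurableSet B → CycleDetermined v D →
    Q (D ∩ cycleShift v ⁻¹' B) = Q D * Q B

theorem Regenerative.measurePreserving {v : ℕ} {Q : Measure (ℕ → Bool)} [IsProbabilityMeasure Q]
    (hQ : Regenerative v Q) : MeasurePreserving (cycleShift v) Q Q := by
  refine ⟨measurable_cycleShift v, Measure.ext fun B hB => ?_⟩
  rw [Measure.map_apply (measurable_cycleShift v) hB]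
  simpa using hQ Set.univ B .univ hB fun _ _ _ _ _ => trivial

/-- The strong law of large numbers for a functional of the successive cycles. -/
theorem Regenerative.strong_law {v : ℕ} {Q : Measure (ℕ → Bool)} [IsProbabilityMeasure Q]
    (hQ : Regenerative v Q) {f : (ℕ → Bool) → ℝ} (hf : Measurable f)
    (hdet : ∀ s, CycleDetermined v (f ⁻¹' s)) (hint : Integrable f Q) :
    ∀ᵐ u ∂Q, Tendsto (fun n : ℕ => (∑ i ∈ Finset.range n, f ((cycleShift v)^[i] u)) / n) atTop
      (nhds (∫ u, f u ∂Q)) := by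
  have hpres := hQ.measurePreserving
  have hmeas : ∀ i, Measurable fun u => f ((cycleShift v)^[i] u) := fun i =>
    hf.comp (hpres.iterate i).measurable
  have hindep : ∀ i j, i < j →
      IndepFun (fun u => f ((cycleShift v)^[i] u)) (fun u => f ((cycleShift v)^[j] u)) Q := by
    intro i j hij
    obtain ⟨k, rfl⟩ := Nat.exists_eq_add_of_lt hij
    rw [indepFun_iff_measure_inter_preimage_eq_mul]
    intro s t hs ht
    have h1 : (fun u => f ((cycleShift v)^[i + k + 1] u)) ⁻¹' t =
        (cycleShift v)^[i] ⁻¹' (cycleShift v ⁻¹' ((fun u => f ((cycleShift v)^[k] u)) ⁻¹' t)) := by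
      ext u
      simp only [Set.mem_preimage, ← Function.iterate_succ_apply, ← Function.iterate_add_apply]
      rw [show k.succ + i = i + k + 1 by omega]
    have h2 : (fun u => f ((cycleShift v)^[i] u)) ⁻¹' s = (cycleShift v)^[i] ⁻¹' (f ⁻¹' s) := rfl
    have hB : MeasurableSet ((fun u => f ((cycleShift v)^[k] u)) ⁻¹' t) := hmeas k ht
    rw [h1, h2, ← Set.preimage_inter, (hpres.iterate i).measure_preimage
      ((hf hs).inter (hpres.measurable hB)).nullMeasurableSet,
      (hpres.iterate i).measure_preimage (hf hs).nullMeasurableSet,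
      (hpres.iterate i).measure_preimage (hpres.measurable hB).nullMeasurableSet,
      hpres.measure_preimage hB.nullMeasurableSet]
    exact hQ _ _ (hf hs) hB (hdet s)
  refine strong_law_ae_real (fun i u => f ((cycleShift v)^[i] u)) hint ?_ fun i => ?_
  · intro i j hij
    rcases lt_or_gt_of_ne hij with h | h
    · exact hindep i j h
    · exact (hindep j i h).symm
  · refine ⟨(hmeas i).aemeasurable, (hmeas 0).aemeasurable, ?_⟩
    have : (fun u => f ((cycleShift v)^[i] u)) = f ∘ (cycleShift v)^[i] := rfl
    rw [this, ← Measure.map_map hf (hpres.iterate i).measurable, (hpres.iterate i).map_eq]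
    rfl

/-- The density of ones along a regenerative sequence. -/
theorem Regenerative.ae_tendsto_ones_div {v : ℕ} (hv : 0 < v) {Q : Measure (ℕ → Bool)}
    [IsProbabilityMeasure Q] (hQ : Regenerative v Q) (hpos : ∀ᵐ u ∂Q, 0 < cycleLength v u)
    (hint : Integrable (fun u => (cycleLength v u : ℝ)) Q) :
    ∀ᵐ u ∂Q, Tendsto (fun n : ℕ => (ones u n : ℝ) / n) atTop
      (nhds ((∫ u, (cycleOnes v u : ℝ) ∂Q) / ∫ u, (cycleLength v u : ℝ) ∂Q)) := by
  have hcast : Measurable (fun n : ℕ => (n : ℝ)) := measurable_of_countable _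
  have hint' : Integrable (fun u => (cycleOnes v u : ℝ)) Q := by
    refine hint.mono' (hcast.comp (measurable_cycleOnes v)).aestronglyMeasurable (ae_of_all _ ?_)
    intro u
    simpa using cycleOnes_le v u
  have hα : 1 ≤ ∫ u, (cycleLength v u : ℝ) ∂Q := by
    have := integral_mono_ae (integrable_const (1 : ℝ)) hint
      (hpos.mono fun u hu => by simpa using Nat.succ_le_of_lt hu)
    simpa using this
  filter_upwards [hQ.strong_law (hcast.comp (measurable_cycleLength v))
      (fun s u u' hu huu' h => by
        simpa [Set.mem_preimage, cycleLength_congr hv hu huu'] using h) hint,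
    hQ.strong_law (hcast.comp (measurable_cycleOnes v))
      (fun s u u' hu huu' h => by
        simpa [Set.mem_preimage, cycleOnes_congr hv hu huu'] using h) hint'] with u h1 h2
  exact tendsto_ones_div (zero_lt_one.trans_le hα) h1 h2

end Sequences

section Blocks

/-- The `l`-th block of length `v` of `u` is `0^{v-1} 1`. -/
def Block (v : ℕ) (u : ℕ → Bool) (l : ℕ) : Prop :=
  (∀ i, i + 1 < v → u (l * v + i) = false) ∧ u (l * v + (v - 1)) = true

theorem Block.endsPattern {v : ℕ} (hv : 0 < v) {u : ℕ → Bool} {l : ℕ} (h : Block v u l) :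
    EndsPattern v u ((l + 1) * v) := by
  have hl : (l + 1) * v = l * v + v := by ring
  refine ⟨by omega, ?_, fun j hj hj' => ?_⟩
  · rw [← h.2]
    congr 1
    omega
  · have := h.1 (j - l * v) (by omega)
    rwa [show l * v + (j - l * v) = j by omega] at this

theorem Block.congr {v : ℕ} (hv : 0 < v) {u u' : ℕ → Bool} {l : ℕ}
    (huu' : ∀ i < (l + 1) * v, u i = u' i) (h : Block v u l) : Block v u' l := by
  have hl : (l + 1) * v = l * v + v := by ring
  refine ⟨fun i hi => ?_, ?_⟩
  · rw [← huu' _ (by omega), h.1 i hi]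
  · rw [← huu' _ (by omega), h.2]

/-- Sequences none of whose first `k` blocks is `0^{v-1} 1`. -/
def noBlock (v k : ℕ) : Set (ℕ → Bool) := {u | ∀ l < k, ¬ Block v u l}

theorem measurableSet_noBlock (v k : ℕ) : MeasurableSet (noBlock v k) := by
  have hc : ∀ (j : ℕ) (b : Bool), MeasurableSet {u : ℕ → Bool | u j = b} := fun j b =>
    measurableSet_eq_fun (measurable_pi_apply j) measurable_const
  have hB : ∀ l, MeasurableSet {u : ℕ → Bool | Block v u l} := by
    intro l
    simp only [Block, Set.ofPred_and, Set.ofPred_forall]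
    exact (MeasurableSet.iInter fun i => .iInter fun _ => hc _ _).inter (hc _ _)
  simp only [noBlock, Set.ofPred_forall]
  exact .iInter fun l => .iInter fun _ => (hB l).compl

variable {v : ℕ} {μ : Measure (ℕ → Bool)} {r : ℝ}

theorem ae_cycleLength_pos (hv : 0 < v) [IsFiniteMeasure μ] (hr0 : 0 ≤ r) (hr : r < 1)
    (h : ∀ k, μ.real (noBlock v k) ≤ r ^ k) : ∀ᵐ u ∂μ, 0 < cycleLength v u := by
  have hsub : ∀ k, {u | ¬ 0 < cycleLength v u} ⊆ noBlock v k := fun k u hu l _ hl =>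
    hu (cycleLength_pos hv (hl.endsPattern hv))
  have hle : ∀ k, μ.real {u | ¬ 0 < cycleLength v u} ≤ r ^ k := fun k =>
    (measureReal_mono (hsub k)).trans (h k)
  have h0 := ge_of_tendsto' (tendsto_pow_atTop_nhds_zero_of_lt_one hr0 hr) hle
  rw [ae_iff, ← measureReal_eq_zero_iff]
  exact le_antisymm h0 measureReal_nonneg

theorem integrable_cycleLength (hv : 0 < v) [IsFiniteMeasure μ] (hr0 : 0 ≤ r) (hr : r < 1)
    (h : ∀ k, μ.real (noBlock v k) ≤ r ^ k) :
    Integrable (fun u => (cycleLength v u : ℝ)) μ := by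
  classical
  have hcast : Measurable (fun n : ℕ => (n : ℝ)) := measurable_of_countable _
  refine ⟨(hcast.comp (measurable_cycleLength v)).aestronglyMeasurable, ?_⟩
  have hbound : ∀ u, ‖(cycleLength v u : ℝ)‖ₑ ≤
      (v : ENNReal) * ∑' k, (noBlock v k).indicator (fun _ => (1 : ENNReal)) u := by
    intro u
    have hn : ‖(cycleLength v u : ℝ)‖ₑ = (cycleLength v u : ENNReal) := by
      simp
    rw [hn]
    by_cases hb : ∃ l, Block v u l
    · have hmin : ∀ l < Nat.find hb, ¬ Block v u l := fun l hl => Nat.find_min hb hl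
      have hlen : cycleLength v u ≤ v * (Nat.find hb + 1) := by
        rw [mul_comm]
        exact Nat.sInf_le ((Nat.find_spec hb).endsPattern hv)
      calc (cycleLength v u : ENNReal) ≤ ((v * (Nat.find hb + 1) : ℕ) : ENNReal) := by
            exact_mod_cast hlen
        _ = v * ∑ k ∈ Finset.range (Nat.find hb + 1),
              (noBlock v k).indicator (fun _ => (1 : ENNReal)) u := by
            rw [Finset.sum_congr rfl (g := fun _ => (1 : ENNReal)) fun k hk => ?_]
            · simp
            · have hu : u ∈ noBlock v k := fun l hl =>
                hmin l (hl.trans_le (Nat.lt_succ_iff.1 (Finset.mem_range.1 hk)))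
              exact Set.indicator_of_mem hu _
        _ ≤ _ := by gcongr; exact ENNReal.sum_le_tsum _
    · have hall : ∀ k, (noBlock v k).indicator (fun _ => (1 : ENNReal)) u = 1 := by
        intro k
        have hu : u ∈ noBlock v k := fun l _ hl => hb ⟨l, hl⟩
        exact Set.indicator_of_mem hu _
      simp [hall, ENNReal.mul_top, hv.ne']
  refine (lintegral_mono hbound).trans_lt ?_
  rw [lintegral_const_mul _ (.tsum fun k =>
      measurable_const.indicator (measurableSet_noBlock v k)),
    lintegral_tsum fun k => (measurable_const.indicator (measurableSet_noBlock v k)).aemeasurable]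
  refine ENNReal.mul_lt_top (by simp) ?_
  have hk : ∀ k, ∫⁻ u, (noBlock v k).indicator (fun _ => (1 : ENNReal)) u ∂μ ≤
      ENNReal.ofReal (r ^ k) := by
    intro k
    rw [lintegral_indicator_const (measurableSet_noBlock v k), one_mul, ← ofReal_measureReal]
    exact ENNReal.ofReal_le_ofReal (h k)
  refine (ENNReal.tsum_le_tsum hk).trans_lt ?_
  rw [← ENNReal.ofReal_tsum_of_nonneg (fun k => pow_nonneg hr0 k)
    (summable_geometric_of_lt_one hr0 hr)]
  exact ENNReal.ofReal_lt_top

theorem tendsto_ones_div_of_shift {u : ℕ → Bool} {N : ℕ} {l : ℝ}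
    (h : Tendsto (fun n : ℕ => (ones (fun i => u (N + i)) n : ℝ) / n) atTop (nhds l)) :
    Tendsto (fun n : ℕ => (ones u n : ℝ) / n) atTop (nhds l) := by
  rw [← tendsto_add_atTop_iff_nat N]
  have h1 : Tendsto (fun n : ℕ => (n : ℝ) / ((n : ℝ) + N)) atTop (nhds 1) :=
    tendsto_natCast_div_add_atTop (N : ℝ)
  have h2 : Tendsto (fun n : ℕ => (ones u N : ℝ) / ((n : ℝ) + N)) atTop (nhds 0) :=
    tendsto_const_nhds.div_atTop
      (tendsto_atTop_add_const_right _ _ tendsto_natCast_atTop_atTop)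
  have h3 := (h.mul h1).add h2
  rw [mul_one, add_zero] at h3
  refine h3.congr' ?_
  filter_upwards [eventually_gt_atTop 0] with n hn
  have : (0 : ℝ) < n := by exact_mod_cast hn
  rw [add_comm n N, ones_add]
  push_cast
  field_simp
  ring

end Blocks

section Chain

attribute [local instance] VLMC.mΩ VLMC.hprob

variable {v : ℕ} {p : ℕ → (Fin (v - 1) → Bool) → ℝ} (S : VLMC v p)

/-- The letters appended after time `N`. -/
def future (N : ℕ) (ω : S.Ω) : ℕ → Bool := fun i => S.X (N + 1 + i) ω

theorem measurable_future (N : ℕ) : Measurable (S.future N) :=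
  measurable_pi_lambda _ fun _ => S.hXmeas _

/-- The event `A` is determined by the letters appended up to time `n`. -/
def DeterminedAt (n : ℕ) (A : Set S.Ω) : Prop :=
  ∀ ω ω' : S.Ω, (∀ i < n, S.X (i + 1) ω = S.X (i + 1) ω') → ω ∈ A → ω' ∈ A

/-- The conditional probability of appending `1` at step `n + 1`. -/
def stepProb (n : ℕ) (ω : S.Ω) : ℝ :=
  p ((n : ℤ) - S.mpos ω n).toNat fun j => S.cfg ω (S.mpos ω n - ((v : ℤ) - 1) + (j.1 : ℤ))

variable {S}

theorem mpos_eq {ω : S.Ω} {n : ℕ} {z : ℤ} (hz : z ≤ n) (h1 : S.cfg ω z = true)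
    (h0 : ∀ i : ℤ, z < i → i ≤ n → S.cfg ω i = false) : S.mpos ω n = z := by
  obtain ⟨ha, hb, hc⟩ := S.hmpos ω n
  rcases lt_trichotomy (S.mpos ω n) z with h | h | h
  · exact absurd (hc z h hz) (by simp [h1])
  · exact h
  · exact absurd (h0 _ h ha) (by simp [hb])

theorem cfg_natCast_succ (ω : S.Ω) (i : ℕ) : S.cfg ω ((i : ℤ) + 1) = S.X (i + 1) ω := by
  rw [S.hcfg, if_neg (by omega)]
  congr 1

theorem cfg_congr {ω ω' : S.Ω} {n : ℕ} (h : ∀ i < n, S.X (i + 1) ω = S.X (i + 1) ω') {i : ℤ}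
    (hi : i ≤ n) : S.cfg ω i = S.cfg ω' i := by
  by_cases h0 : i ≤ 0
  · rw [S.hcfg, S.hcfg, if_pos h0, if_pos h0]
  · obtain ⟨k, rfl⟩ : ∃ k : ℕ, i = (k : ℤ) + 1 := ⟨(i - 1).toNat, by omega⟩
    rw [cfg_natCast_succ, cfg_natCast_succ, h k (by omega)]

theorem mpos_congr {ω ω' : S.Ω} {n : ℕ} (h : ∀ i < n, S.X (i + 1) ω = S.X (i + 1) ω') :
    S.mpos ω' n = S.mpos ω n := by
  obtain ⟨ha, hb, hc⟩ := S.hmpos ω n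
  exact mpos_eq ha (by rw [← cfg_congr h ha, hb]) fun i hi hi' => by
    rw [← cfg_congr h hi', hc i hi hi']

theorem hitY0_iff {ω : S.Ω} {n : ℕ} : S.hitY0 ω n ↔ S.cfg ω n = true ∧
    ∀ i : ℤ, (n : ℤ) - v < i → i < n → S.cfg ω i = false := by
  have hv := S.hv
  constructor
  · rintro ⟨h1, h2⟩
    refine ⟨by simpa [h1] using (S.hmpos ω n).2.1, fun i hi hi' => ?_⟩
    have := h2 ⟨(i - (n - (v - 1))).toNat, by omega⟩
    rw [← this]
    congr 1
    simp only
    omega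
  · rintro ⟨h1, h2⟩
    exact ⟨mpos_eq le_rfl h1 fun i hi hi' => by omega, fun j => h2 _ (by omega) (by omega)⟩

namespace DeterminedAt

variable {n m : ℕ} {A B : Set S.Ω}

theorem mono (hA : S.DeterminedAt n A) (h : n ≤ m) : S.DeterminedAt m A :=
  fun ω ω' hω => hA ω ω' fun i hi => hω i (hi.trans_le h)

theorem inter (hA : S.DeterminedAt n A) (hB : S.DeterminedAt n B) : S.DeterminedAt n (A ∩ B) :=
  fun ω ω' hω h => ⟨hA ω ω' hω h.1, hB ω ω' hω h.2⟩

theorem exists_eq_preimage (hA : S.DeterminedAt n A) :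
    ∃ s : Finset (Fin n → Bool),
      A = (fun ω (i : Fin n) => S.X (i.1 + 1) ω) ⁻¹' s ∧
      ∀ b ∈ s, ∃ ω ∈ A, ∀ i : Fin n, S.X (i.1 + 1) ω = b i := by
  classical
  refine ⟨Finset.univ.filter fun b => ∃ ω ∈ A, ∀ i : Fin n, S.X (i.1 + 1) ω = b i, ?_, ?_⟩
  · ext ω
    simp only [Finset.coe_filter, Finset.mem_univ, true_and, Set.mem_preimage, Set.mem_ofPred_eq]
    exact ⟨fun h => ⟨ω, h, fun _ => rfl⟩, fun ⟨ω', h, h'⟩ => hA ω' ω (fun i hi => h' ⟨i, hi⟩) h⟩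
  · simp

theorem measurableSet (hA : S.DeterminedAt n A) : MeasurableSet A := by
  obtain ⟨s, rfl, -⟩ := hA.exists_eq_preimage
  exact (measurable_pi_lambda _ fun _ => S.hXmeas _) s.measurableSet

end DeterminedAt

theorem determinedAt_hitY0 (n : ℕ) : S.DeterminedAt n {ω | S.hitY0 ω n} := by
  intro ω ω' hω h
  simp only [Set.mem_ofPred_eq, hitY0_iff] at h ⊢
  refine ⟨by rw [← cfg_congr hω le_rfl, h.1], fun i hi hi' => ?_⟩
  rw [← cfg_congr hω hi'.le, h.2 i hi hi']

theorem determinedAt_future {N m : ℕ} {D : Set (ℕ → Bool)}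
    (hD : ∀ u u' : ℕ → Bool, (∀ i < m, u i = u' i) → u ∈ D → u' ∈ D) :
    S.DeterminedAt (N + m) (S.future N ⁻¹' D) := by
  intro ω ω' hω h
  refine hD _ _ (fun i hi => ?_) h
  have := hω (N + i) (by omega)
  rwa [show N + i + 1 = N + 1 + i by omega] at this

theorem measurableSet_X (n : ℕ) (b : Bool) : MeasurableSet {ω | S.X n ω = b} :=
  measurableSet_eq_fun (S.hXmeas n) measurable_const

theorem measureReal_cylinder_step (hp : ∀ k w, 0 ≤ p k w) (n : ℕ) (ω : S.Ω) (b : Fin n → Bool)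
    (hb : ∀ i : Fin n, S.X (i.1 + 1) ω = b i) :
    S.P.real ((fun ω (i : Fin n) => S.X (i.1 + 1) ω) ⁻¹' {b} ∩ {ω | S.X (n + 1) ω = true}) =
      S.stepProb n ω * S.P.real ((fun ω (i : Fin n) => S.X (i.1 + 1) ω) ⁻¹' {b}) := by
  have hset : (fun ω (i : Fin n) => S.X (i.1 + 1) ω) ⁻¹' {b} =
      {ω | ∀ i : Fin n, S.X (i.1 + 1) ω = b i} := by
    ext ω
    simp [funext_iff]
  have hle := (S.hmpos ω n).1
  have h := S.htrans n b ((n : ℤ) - S.mpos ω n).toNat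
    (fun j => S.cfg ω (S.mpos ω n - ((v : ℤ) - 1) + (j.1 : ℤ))) fun ω' hω' => by
      have hag : ∀ i < n, S.X (i + 1) ω = S.X (i + 1) ω' := fun i hi => by
        rw [hb ⟨i, hi⟩, hω' ⟨i, hi⟩]
      rw [mpos_congr hag]
      refine ⟨by omega, fun j => (cfg_congr hag ?_).symm⟩
      have := j.2
      omega
  rw [hset, Measure.real, Measure.real, ← Set.ofPred_and, h, ENNReal.toReal_mul,
    ENNReal.toReal_ofReal (hp _ _)]
  rfl

theorem measureReal_word_inter {n : ℕ} {s : Finset (Fin n → Bool)} (E : Set S.Ω) :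
    S.P.real ((fun ω (i : Fin n) => S.X (i.1 + 1) ω) ⁻¹' s ∩ E) =
      ∑ b ∈ s, S.P.real ((fun ω (i : Fin n) => S.X (i.1 + 1) ω) ⁻¹' {b} ∩ E) := by
  have hm : Measurable fun (ω : S.Ω) (i : Fin n) => S.X (i.1 + 1) ω :=
    measurable_pi_lambda _ fun _ => S.hXmeas _
  have := sum_measureReal_preimage_singleton (μ := S.P.restrict E) s
    (f := fun (ω : S.Ω) (i : Fin n) => S.X (i.1 + 1) ω) fun b _ => hm (measurableSet_singleton b)
  rw [measureReal_restrict_apply (hm s.measurableSet)] at this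
  rw [← this]
  exact Finset.sum_congr rfl fun b _ =>
    measureReal_restrict_apply (hm (measurableSet_singleton b))

theorem DeterminedAt.mul_le_measureReal_inter {n : ℕ} {A : Set S.Ω} (hA : S.DeterminedAt n A)
    (hp : ∀ k w, 0 ≤ p k w) {c : ℝ} (hc : ∀ ω ∈ A, c ≤ S.stepProb n ω) :
    c * S.P.real A ≤ S.P.real (A ∩ {ω | S.X (n + 1) ω = true}) := by
  obtain ⟨s, hs, hs'⟩ := hA.exists_eq_preimage
  have h1 := measureReal_word_inter (S := S) (s := s) Set.univ
  simp only [Set.inter_univ] at h1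
  rw [hs, measureReal_word_inter, h1, Finset.mul_sum]
  refine Finset.sum_le_sum fun b hb => ?_
  obtain ⟨ω, hω, hωb⟩ := hs' b hb
  rw [measureReal_cylinder_step hp n ω b hωb]
  exact mul_le_mul_of_nonneg_right (hc ω hω) measureReal_nonneg

theorem DeterminedAt.measureReal_inter_le {n : ℕ} {A : Set S.Ω} (hA : S.DeterminedAt n A)
    (hp : ∀ k w, 0 ≤ p k w) {c : ℝ} (hc : ∀ ω ∈ A, S.stepProb n ω ≤ c) :
    S.P.real (A ∩ {ω | S.X (n + 1) ω = true}) ≤ c * S.P.real A := by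
  obtain ⟨s, hs, hs'⟩ := hA.exists_eq_preimage
  have h1 := measureReal_word_inter (S := S) (s := s) Set.univ
  simp only [Set.inter_univ] at h1
  rw [hs, measureReal_word_inter, h1, Finset.mul_sum]
  refine Finset.sum_le_sum fun b hb => ?_
  obtain ⟨ω, hω, hωb⟩ := hs' b hb
  rw [measureReal_cylinder_step hp n ω b hωb]
  exact mul_le_mul_of_nonneg_right (hc ω hω) measureReal_nonneg

theorem measureReal_inter_false (A : Set S.Ω) (n : ℕ) :
    S.P.real (A ∩ {ω | S.X n ω = false}) =
      S.P.real A - S.P.real (A ∩ {ω | S.X n ω = true}) := by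
  have h := measureReal_inter_add_sdiff (μ := S.P) (s := A) (measurableSet_X n true)
  have hd : A \ {ω | S.X n ω = true} = A ∩ {ω | S.X n ω = false} := by
    ext ω
    simp
  rw [hd] at h
  linarith

/-! ### Visits to `y₀` and the letters appended afterwards -/

theorem cfg_add_eq_future (ω : S.Ω) (N i : ℕ) :
    S.cfg ω ((N : ℤ) + 1 + i) = S.future N ω i := by
  have := cfg_natCast_succ ω (N + i)
  rw [future, show N + 1 + i = N + i + 1 by omega, ← this]
  congr 1
  push_cast
  ring

theorem hitY0_add_of_endsPattern {ω : S.Ω} {N m : ℕ} (h : EndsPattern v (S.future N ω) m) :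
    S.hitY0 ω (N + m) := by
  have hv := S.hv
  obtain ⟨h1, h2, h3⟩ := h
  rw [hitY0_iff]
  refine ⟨?_, fun i hi hi' => ?_⟩
  · rw [← h2, ← cfg_add_eq_future]
    congr 1
    omega
  · rw [← h3 (i - N - 1).toNat (by omega) (by omega), ← cfg_add_eq_future]
    congr 1
    omega

theorem endsPattern_of_hitY0_add {ω : S.Ω} {N m : ℕ} (hN : S.hitY0 ω N) (hm : 0 < m)
    (h : S.hitY0 ω (N + m)) : EndsPattern v (S.future N ω) m := by
  rw [hitY0_iff] at h hN
  refine ⟨not_lt.1 fun hlt => ?_, ?_, fun j hj hj' => ?_⟩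
  · exact absurd (h.2 N (by omega) (by omega)) (by simp [hN.1])
  · rw [← cfg_add_eq_future, ← h.1]
    congr 1
    omega
  · rw [← cfg_add_eq_future, h.2 _ (by omega) (by omega)]

theorem cfg_add_congr_of_hitY0 {ω ω' : S.Ω} {N N' m : ℕ} (h : S.hitY0 ω N) (h' : S.hitY0 ω' N')
    (hm : ∀ i < m, S.future N ω i = S.future N' ω' i) {z : ℤ} (hz : -(v : ℤ) < z) (hzm : z ≤ m) :
    S.cfg ω (N + z) = S.cfg ω' (N' + z) := by
  rw [hitY0_iff] at h h'
  rcases lt_trichotomy z 0 with h0 | rfl | h0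
  · rw [h.2 _ (by omega) (by omega), h'.2 _ (by omega) (by omega)]
  · rw [add_zero, add_zero, h.1, h'.1]
  · obtain ⟨k, rfl⟩ : ∃ k : ℕ, z = 1 + (k : ℤ) := ⟨(z - 1).toNat, by omega⟩
    rw [← add_assoc, ← add_assoc, cfg_add_eq_future, cfg_add_eq_future, hm k (by omega)]

/-- After a visit to `y₀` the transition probabilities depend only on the letters appended
since that visit. -/
theorem stepProb_congr_of_hitY0 {ω ω' : S.Ω} {N N' m : ℕ} (h : S.hitY0 ω N) (h' : S.hitY0 ω' N')
    (hm : ∀ i < m, S.future N ω i = S.future N' ω' i) :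
    S.stepProb (N + m) ω = S.stepProb (N' + m) ω' := by
  have hv := S.hv
  have hcfg := fun (z : ℤ) => cfg_add_congr_of_hitY0 h h' hm (z := z)
  obtain ⟨ha, hb, hc⟩ := S.hmpos ω (N + m)
  have hN : (N : ℤ) ≤ S.mpos ω (N + m) := by
    by_contra hlt
    exact absurd (hc N (by omega) (by omega)) (by simp [(hitY0_iff.1 h).1])
  obtain ⟨z, hz⟩ : ∃ z : ℤ, S.mpos ω (N + m) = N + z := ⟨_, (add_sub_cancel _ _).symm⟩
  rw [hz] at ha hb hc hN
  have hz' : S.mpos ω' (N' + m) = N' + z := by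
    refine mpos_eq (by omega) ?_ fun i hi hi' => ?_
    · rw [← hcfg z (by omega) (by omega), hb]
    · have := hcfg (i - N') (by omega) (by omega)
      rw [add_sub_cancel] at this
      rw [← this, hc _ (by omega) (by omega)]
  rw [stepProb, stepProb, hz, hz']
  congr 1
  · omega
  · funext j
    have := hcfg (z - ((v : ℤ) - 1) + j) (by omega) (by omega)
    convert this using 2 <;> ring

/-- The law of the letters appended after a visit to `y₀`, on cylinders. -/
theorem exists_cylinderWeight (hp : ∀ k w, 0 ≤ p k w) :
    ∃ w : ℕ → (ℕ → Bool) → ℝ, ∀ (m : ℕ) (u : ℕ → Bool) (N : ℕ) (A : Set S.Ω),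
      S.DeterminedAt N A → (∀ ω ∈ A, S.hitY0 ω N) →
      S.P.real (A ∩ S.future N ⁻¹' {x | ∀ i < m, x i = u i}) = w m u * S.P.real A := by
  classical
  have hg : ∀ (m : ℕ) (u : ℕ → Bool), ∃ c : ℝ, ∀ (N : ℕ) (ω : S.Ω), S.hitY0 ω N →
      (∀ i < m, S.future N ω i = u i) → S.stepProb (N + m) ω = c := by
    intro m u
    by_cases h : ∃ (N : ℕ) (ω : S.Ω), S.hitY0 ω N ∧ ∀ i < m, S.future N ω i = u i
    · obtain ⟨N', ω', h1, h2⟩ := h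
      exact ⟨_, fun N ω h h' => stepProb_congr_of_hitY0 h h1 fun i hi => by rw [h' i hi, h2 i hi]⟩
    · exact ⟨0, fun N ω h1 h2 => absurd ⟨N, ω, h1, h2⟩ h⟩
  choose g hg using hg
  refine ⟨fun m u => ∏ i ∈ Finset.range m, if u i = true then g i u else 1 - g i u, ?_⟩
  intro m u N A hA hhit
  induction m with
  | zero => simp
  | succ m ih =>
    have hdet : S.DeterminedAt (N + m) (A ∩ S.future N ⁻¹' {x | ∀ i < m, x i = u i}) :=
      (hA.mono (by omega)).inter (determinedAt_future fun x x' hx h i hi => by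
        rw [← hx i hi, h i hi])
    have hstep : ∀ ω ∈ A ∩ S.future N ⁻¹' {x | ∀ i < m, x i = u i},
        S.stepProb (N + m) ω = g m u := fun ω hω => hg m u N ω (hhit ω hω.1) hω.2
    have htrue := le_antisymm (hdet.measureReal_inter_le hp fun ω hω => (hstep ω hω).le)
      (hdet.mul_le_measureReal_inter hp fun ω hω => (hstep ω hω).ge)
    have hsplit : A ∩ S.future N ⁻¹' {x | ∀ i < m + 1, x i = u i} =
        A ∩ S.future N ⁻¹' {x | ∀ i < m, x i = u i} ∩ {ω | S.X (N + m + 1) ω = u m} := by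
      ext ω
      simp only [Set.mem_inter_iff, Set.mem_preimage, Set.mem_ofPred_eq, Nat.forall_lt_succ_right,
        and_assoc, future, show N + 1 + m = N + m + 1 by omega]
    simp only [hsplit, Finset.prod_range_succ]
    simp only at ih
    cases hum : u m
    · rw [measureReal_inter_false, htrue, ih, if_neg (by simp)]
      ring
    · rw [htrue, ih, if_pos rfl]
      ring

end Chain

section Regeneration

attribute [local instance] VLMC.mΩ VLMC.hprob

variable {v : ℕ} {p : ℕ → (Fin (v - 1) → Bool) → ℝ} {S : VLMC v p} {δ1 δ2 : ℝ}

/-- The lower bound for the probability that the next `v` letters are `0^{v-1} 1`. -/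
theorem DeterminedAt.mul_le_measureReal_block {n : ℕ} {A : Set S.Ω} (hA : S.DeterminedAt n A)
    (hp : ∀ k w, 0 ≤ p k w) (h1 : δ1 ≤ 1) (h2 : 0 ≤ δ2) (hδ : ∀ k w, δ2 ≤ p k w ∧ p k w ≤ δ1) :
    δ2 * (1 - δ1) ^ (v - 1) * S.P.real A ≤
      S.P.real (A ∩ S.future n ⁻¹' {u | Block v u 0}) := by
  have hv := S.hv
  have hdet : ∀ j, S.DeterminedAt (n + j) (A ∩ S.future n ⁻¹' {u | ∀ i < j, u i = false}) :=
    fun j => (hA.mono (by omega)).inter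
      (determinedAt_future fun x x' hx h i hi => by rw [← hx i hi, h i hi])
  have hzeros : ∀ j, (1 - δ1) ^ j * S.P.real A ≤
      S.P.real (A ∩ S.future n ⁻¹' {u | ∀ i < j, u i = false}) := by
    intro j
    induction j with
    | zero => simp
    | succ j ih =>
      have hsplit : A ∩ S.future n ⁻¹' {u | ∀ i < j + 1, u i = false} =
          A ∩ S.future n ⁻¹' {u | ∀ i < j, u i = false} ∩ {ω | S.X (n + j + 1) ω = false} := by
        ext ω
        simp only [Set.mem_inter_iff, Set.mem_preimage, Set.mem_ofPred_eq,
          Nat.forall_lt_succ_right, and_assoc, future, show n + 1 + j = n + j + 1 by omega]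
      have hup := (hdet j).measureReal_inter_le hp (c := δ1) fun ω _ => (hδ _ _).2
      rw [hsplit, measureReal_inter_false, pow_succ]
      nlinarith [mul_le_mul_of_nonneg_left ih (sub_nonneg.2 h1)]
  have hlow := (hdet (v - 1)).mul_le_measureReal_inter hp (c := δ2) fun ω _ => (hδ _ _).1
  have hsplit : A ∩ S.future n ⁻¹' {u | Block v u 0} =
      A ∩ S.future n ⁻¹' {u | ∀ i < v - 1, u i = false} ∩
        {ω | S.X (n + (v - 1) + 1) ω = true} := by
    ext ω
    simp only [Set.mem_inter_iff, Set.mem_preimage, Set.mem_ofPred_eq, and_assoc, Block, future,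
      zero_mul, zero_add, Nat.lt_sub_iff_add_lt, show n + 1 + (v - 1) = n + (v - 1) + 1 by omega]
  rw [hsplit, mul_assoc]
  exact (mul_le_mul_of_nonneg_left (hzeros (v - 1)) h2).trans hlow

theorem DeterminedAt.measureReal_noBlock_le {n : ℕ} {A : Set S.Ω} (hA : S.DeterminedAt n A)
    (hp : ∀ k w, 0 ≤ p k w) (h1 : δ1 ≤ 1) (h2 : 0 ≤ δ2) (hδ : ∀ k w, δ2 ≤ p k w ∧ p k w ≤ δ1)
    (hc : δ2 * (1 - δ1) ^ (v - 1) ≤ 1) (k : ℕ) :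
    S.P.real (A ∩ S.future n ⁻¹' noBlock v k) ≤
      (1 - δ2 * (1 - δ1) ^ (v - 1)) ^ k * S.P.real A := by
  have hv := S.hv
  induction k with
  | zero => simp [noBlock]
  | succ k ih =>
    have hdet : S.DeterminedAt (n + k * v) (A ∩ S.future n ⁻¹' noBlock v k) :=
      (hA.mono (by omega)).inter (determinedAt_future fun x x' hx h l hl hb =>
        h l hl (hb.congr hv fun i hi => (hx i (hi.trans_le (Nat.mul_le_mul_right v hl))).symm))
    have hblock := hdet.mul_le_measureReal_block hp h1 h2 hδ
    have hm : MeasurableSet (S.future (n + k * v) ⁻¹' {u | Block v u 0}) := by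
      have := (measurableSet_noBlock v 1).compl
      have hset : (noBlock v 1)ᶜ = {u | Block v u 0} := by
        ext u
        simp [noBlock]
      exact S.measurable_future _ (hset ▸ this)
    have hsplit : A ∩ S.future n ⁻¹' noBlock v (k + 1) =
        (A ∩ S.future n ⁻¹' noBlock v k) \ (S.future (n + k * v) ⁻¹' {u | Block v u 0}) := by
      ext ω
      have hb : Block v (S.future n ω) k ↔ Block v (S.future (n + k * v) ω) 0 := by
        have : ∀ i, n + k * v + 1 + i = n + 1 + (k * v + i) := fun i => by ring
        simp only [Block, future, zero_mul, zero_add, this]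
      simp only [Set.mem_inter_iff, Set.mem_preimage, Set.mem_sdiff, Set.mem_ofPred_eq, noBlock,
        Nat.forall_lt_succ_right, and_assoc, hb]
    have hdiff := measureReal_inter_add_sdiff (μ := S.P) (s := A ∩ S.future n ⁻¹' noBlock v k) hm
    rw [← hsplit] at hdiff
    rw [pow_succ]
    nlinarith [mul_le_mul_of_nonneg_left ih (sub_nonneg.2 hc)]

/-- `Q` is the law of the letters appended after a visit to `y₀`. -/
def IsFutureLaw (S : VLMC v p) (Q : Measure (ℕ → Bool)) : Prop :=
  ∀ (N : ℕ) (A : Set S.Ω), S.DeterminedAt N A → (∀ ω ∈ A, S.hitY0 ω N) →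
    ∀ B, MeasurableSet B → S.P (A ∩ S.future N ⁻¹' B) = S.P A * Q B

theorem exists_isFutureLaw (hp : ∀ k w, 0 ≤ p k w) {N₀ : ℕ} (hN₀ : S.P {ω | S.hitY0 ω N₀} ≠ 0) :
    ∃ Q : Measure (ℕ → Bool), IsProbabilityMeasure Q ∧ S.IsFutureLaw Q := by
  obtain ⟨w, hw⟩ := exists_cylinderWeight (S := S) hp
  set H : Set S.Ω := {ω | S.hitY0 ω N₀}
  have hHdet : S.DeterminedAt N₀ H := determinedAt_hitY0 N₀
  set Q : Measure (ℕ → Bool) := (S.P H)⁻¹ • (S.P.restrict H).map (S.future N₀) with hQ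
  have hQapp : ∀ B, MeasurableSet B → Q B = (S.P H)⁻¹ * S.P (H ∩ S.future N₀ ⁻¹' B) := by
    intro B hB
    rw [hQ, Measure.smul_apply, smul_eq_mul, Measure.map_apply (S.measurable_future _) hB,
      Measure.restrict_apply (S.measurable_future _ hB), Set.inter_comm]
  have hprob : IsProbabilityMeasure Q := by
    refine ⟨?_⟩
    rw [hQapp _ .univ, Set.preimage_univ, Set.inter_univ,
      ENNReal.inv_mul_cancel hN₀ (measure_ne_top _ _)]
  refine ⟨Q, hprob, fun N A hA hhit B hB => ?_⟩
  have hmeas : (S.P.restrict A).map (S.future N) = S.P A • Q := by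
    have : IsFiniteMeasure (S.P A • Q) := Measure.smul_finite _ (measure_ne_top _ _)
    refine measure_ext_of_cylinder fun m u => ?_
    have hcyl : MeasurableSet {x : ℕ → Bool | ∀ i < m, x i = u i} := by
      simp only [Set.ofPred_forall]
      exact .iInter fun i => .iInter fun _ =>
        measurableSet_eq_fun (measurable_pi_apply i) measurable_const
    rw [Measure.map_apply (S.measurable_future _) hcyl,
      Measure.restrict_apply (S.measurable_future _ hcyl), Set.inter_comm,
      Measure.smul_apply, smul_eq_mul, hQapp _ hcyl]
    have e1 := hw m u N A hA hhit
    have e2 := hw m u N₀ H hHdet fun ω hω => hω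
    have hpos : S.P.real H ≠ 0 := by rwa [ne_eq, measureReal_eq_zero_iff]
    refine (ENNReal.toReal_eq_toReal_iff' (measure_ne_top _ _)
      (by finiteness)).1 ?_
    rw [ENNReal.toReal_mul, ENNReal.toReal_mul, ENNReal.toReal_inv]
    simp only [← Measure.real_def]
    rw [e1, e2]
    field_simp
  have := congrArg (fun μ : Measure (ℕ → Bool) => μ B) hmeas
  simp only [Measure.smul_apply, smul_eq_mul] at this
  rwa [Measure.map_apply (S.measurable_future _) hB,
      Measure.restrict_apply (S.measurable_future _ hB), Set.inter_comm] at this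

theorem IsFutureLaw.regenerative {Q : Measure (ℕ → Bool)} (hQ : S.IsFutureLaw Q)
    (hpos : ∀ᵐ u ∂Q, 0 < cycleLength v u) {N₀ : ℕ} (hN₀ : S.P {ω | S.hitY0 ω N₀} ≠ 0) :
    Regenerative v Q := by
  have hv := S.hv
  intro D B hD hB hdet
  set H : Set S.Ω := {ω | S.hitY0 ω N₀}
  have hHdet : S.DeterminedAt N₀ H := determinedAt_hitY0 N₀
  have hlen := measurable_cycleLength v
  have hshift := measurable_cycleShift v
  rw [measure_eq_tsum_inter_fiber Q hlen, measure_eq_tsum_inter_fiber Q hlen D,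
    ← ENNReal.tsum_mul_right]
  refine tsum_congr fun m => ?_
  have hm : MeasurableSet (cycleLength v ⁻¹' {m}) := hlen (measurableSet_singleton m)
  rcases Nat.eq_zero_or_pos m with rfl | hm0
  · have hnull : Q (cycleLength v ⁻¹' {0}) = 0 := by
      rw [ae_iff] at hpos
      refine measure_mono_null (fun u hu => ?_) hpos
      simpa using hu
    rw [measure_mono_null Set.inter_subset_right hnull,
      measure_mono_null Set.inter_subset_right hnull, zero_mul]
  · have hAdet : S.DeterminedAt (N₀ + m)
        (H ∩ S.future N₀ ⁻¹' (D ∩ cycleLength v ⁻¹' {m})) := by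
      refine (hHdet.mono (by omega)).inter (determinedAt_future fun u u' huu' hu => ?_)
      obtain ⟨hu1, hu2⟩ := hu
      have hu2 : cycleLength v u = m := hu2
      subst hu2
      exact ⟨hdet u u' hm0 huu' hu1, cycleLength_congr hv hm0 huu'⟩
    have hAhit : ∀ ω ∈ H ∩ S.future N₀ ⁻¹' (D ∩ cycleLength v ⁻¹' {m}), S.hitY0 ω (N₀ + m) := by
      rintro ω ⟨-, -, hω⟩
      have hω : cycleLength v (S.future N₀ ω) = m := hω
      subst hω
      exact hitY0_add_of_endsPattern (endsPattern_cycleLength hm0)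
    have e1 := hQ (N₀ + m) _ hAdet hAhit B hB
    have e2 := hQ N₀ H hHdet (fun ω hω => hω) (D ∩ cycleLength v ⁻¹' {m}) (hD.inter hm)
    have e3 := hQ N₀ H hHdet (fun ω hω => hω) (D ∩ cycleShift v ⁻¹' B ∩ cycleLength v ⁻¹' {m})
      ((hD.inter (hshift hB)).inter hm)
    have hset : H ∩ S.future N₀ ⁻¹' (D ∩ cycleShift v ⁻¹' B ∩ cycleLength v ⁻¹' {m}) =
        H ∩ S.future N₀ ⁻¹' (D ∩ cycleLength v ⁻¹' {m}) ∩ S.future (N₀ + m) ⁻¹' B := by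
      ext ω
      have hs : cycleLength v (S.future N₀ ω) = m →
          cycleShift v (S.future N₀ ω) = S.future (N₀ + m) ω := by
        intro h
        funext i
        rw [cycleShift, h, future, future]
        congr 1
        omega
      simp only [Set.mem_inter_iff, Set.mem_preimage, Set.mem_singleton_iff]
      constructor
      · rintro ⟨h1, ⟨h2, h3⟩, h4⟩
        exact ⟨⟨h1, h2, h4⟩, hs h4 ▸ h3⟩
      · rintro ⟨⟨h1, h2, h4⟩, h3⟩
        exact ⟨h1, ⟨h2, (hs h4).symm ▸ h3⟩, h4⟩
    rw [hset, e1, e2, mul_assoc] at e3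
    exact ((ENNReal.mul_right_inj hN₀ (measure_ne_top _ _)).1 e3).symm

/-! ### The first visit to `y₀` -/

theorem T_one (ω : S.Ω) : S.T 1 ω = sInf {n | 0 < n ∧ S.hitY0 ω n} := by
  simp only [T]

theorem measurable_T_one : Measurable (S.T 1) := by
  have : S.T 1 = fun ω => sInf {n | 0 < n ∧ S.hitY0 ω n} := funext T_one
  rw [this]
  refine measurable_sInf_setOf fun n => ?_
  simp only [Set.ofPred_and]
  exact (MeasurableSet.const _).inter (determinedAt_hitY0 n).measurableSet

theorem hitY0_T_one {ω : S.Ω} (h : 0 < S.T 1 ω) : S.hitY0 ω (S.T 1 ω) := by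
  rw [T_one] at h ⊢
  exact (Nat.sInf_mem (Nat.nonempty_of_pos_sInf h)).2

theorem T_one_pos {ω : S.Ω} {n : ℕ} (hn : 0 < n) (h : S.hitY0 ω n) : 0 < S.T 1 ω := by
  rw [T_one]
  exact (Nat.sInf_mem (s := {n | 0 < n ∧ S.hitY0 ω n}) ⟨n, hn, h⟩).1

theorem determinedAt_T_one {n : ℕ} (hn : 0 < n) : S.DeterminedAt n (S.T 1 ⁻¹' {n}) := by
  intro ω ω' hω h
  have h : S.T 1 ω = n := h
  have hle : ∀ {ω ω' : S.Ω} {m : ℕ}, (∀ i < n, S.X (i + 1) ω = S.X (i + 1) ω') →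
      S.T 1 ω = m → 0 < m → m ≤ n → S.T 1 ω' ≤ m := by
    intro ω ω' m hω h hm hmn
    have hhit : S.hitY0 ω m := h ▸ hitY0_T_one (h.symm ▸ hm)
    rw [T_one]
    exact Nat.sInf_le ⟨hm, (determinedAt_hitY0 m).mono hmn ω ω' hω hhit⟩
  have h1 := hle hω h hn le_rfl
  have hpos : 0 < S.T 1 ω' :=
    T_one_pos hn (determinedAt_hitY0 n ω ω' hω (h ▸ hitY0_T_one (h.symm ▸ hn)))
  have h2 := hle (fun i hi => (hω i hi).symm) rfl hpos h1
  exact le_antisymm h1 (h ▸ h2)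

/-- The letters appended after the first visit to `y₀`. -/
def futureT (S : VLMC v p) (ω : S.Ω) : ℕ → Bool := S.future (S.T 1 ω) ω

theorem IsFutureLaw.measurePreserving {Q : Measure (ℕ → Bool)} (hQ : S.IsFutureLaw Q)
    (hT : ∀ᵐ ω ∂S.P, 0 < S.T 1 ω) : MeasurePreserving S.futureT S.P Q := by
  have hmeas : Measurable S.futureT := by
    have h : Measurable fun x : ℕ × S.Ω => S.future x.1 x.2 :=
      measurable_from_prod_countable_right fun n => S.measurable_future n
    exact h.comp (measurable_T_one.prodMk measurable_id)
  refine ⟨hmeas, Measure.ext fun B hB => ?_⟩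
  rw [Measure.map_apply hmeas hB, measure_eq_tsum_inter_fiber S.P measurable_T_one]
  have hterm : ∀ n, S.P (S.futureT ⁻¹' B ∩ S.T 1 ⁻¹' {n}) = S.P (S.T 1 ⁻¹' {n}) * Q B := by
    intro n
    rcases Nat.eq_zero_or_pos n with rfl | hn
    · have hnull : S.P (S.T 1 ⁻¹' {0}) = 0 := by
        rw [ae_iff] at hT
        refine measure_mono_null (fun ω hω => ?_) hT
        simpa using hω
      rw [measure_mono_null Set.inter_subset_right hnull, hnull, zero_mul]
    · rw [← hQ n _ (determinedAt_T_one hn) (fun ω hω => ?_) B hB]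
      · congr 1
        ext ω
        simp only [Set.mem_inter_iff, Set.mem_preimage, Set.mem_singleton_iff, futureT]
        constructor
        · rintro ⟨h, rfl⟩
          exact ⟨rfl, h⟩
        · rintro ⟨rfl, h⟩
          exact ⟨h, rfl⟩
      · have hω : S.T 1 ω = n := hω
        subst hω
        exact hitY0_T_one hn
  have htotal := measure_eq_tsum_inter_fiber S.P (measurable_T_one (S := S)) Set.univ
  simp only [Set.univ_inter, measure_univ] at htotal
  rw [tsum_congr hterm, ENNReal.tsum_mul_right, ← htotal, one_mul]

theorem T_two {ω : S.Ω} (hT : 0 < S.T 1 ω) (hlen : 0 < cycleLength v (S.futureT ω)) :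
    S.T 2 ω = S.T 1 ω + cycleLength v (S.futureT ω) := by
  have hdef : S.T 2 ω = sInf {n | S.T 1 ω < n ∧ S.hitY0 ω n} := by
    conv_lhs => rw [T]
  have hmem : S.T 1 ω + cycleLength v (S.futureT ω) ∈ {n | S.T 1 ω < n ∧ S.hitY0 ω n} :=
    ⟨by omega, hitY0_add_of_endsPattern (endsPattern_cycleLength hlen)⟩
  rw [hdef]
  refine le_antisymm (Nat.sInf_le hmem) ?_
  obtain ⟨h1, h2⟩ := Nat.sInf_mem (s := {n | S.T 1 ω < n ∧ S.hitY0 ω n}) ⟨_, hmem⟩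
  obtain ⟨m, hm⟩ := Nat.exists_eq_add_of_lt h1
  rw [hm] at h2 ⊢
  rw [add_assoc] at h2 ⊢
  have : cycleLength v (S.futureT ω) ≤ m + 1 :=
    Nat.sInf_le (endsPattern_of_hitY0_add (hitY0_T_one hT) (by omega) h2)
  omega

theorem sum_Ioc_eq_ones_future (ω : S.Ω) (N n : ℕ) :
    ∑ k ∈ Finset.Ioc N (N + n), (S.X k ω).toNat = ones (S.future N ω) n := by
  induction n with
  | zero => simp [ones]
  | succ n ih =>
    rw [← add_assoc, Finset.sum_Ioc_succ_top (by omega), ih, ones, ones, Finset.sum_range_succ,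
      future, show N + 1 + n = N + n + 1 by omega]

theorem R_eq_ones (ω : S.Ω) (n : ℕ) : S.R n ω = ones (S.future 0 ω) n := by
  rw [← sum_Ioc_eq_ones_future, zero_add]
  rfl

end Regeneration

end VLMC

namespace VLMC

/-- Theorem 1.5(1): under condition [A], the strong law of large
numbers holds: `R(n)/n → a` almost surely, where `a = E ζ / E τ`. -/
theorem statement0 {v : ℕ} {p : ℕ → (Fin (v - 1) → Bool) → ℝ} (S : VLMC v p)
    (hA : ∃ δ1 δ2 : ℝ, S.CondA δ1 δ2) :
    ∀ᵐ ω ∂S.P,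
      Filter.Tendsto (fun n : ℕ => (S.R n ω : ℝ) / n) Filter.atTop (nhds S.a) := by
  let _ := S.mΩ
  have := S.hprob
  obtain ⟨δ1, δ2, -, h2, h21, h1, hδ⟩ := hA
  have hv := S.hv
  have hp : ∀ k w, 0 ≤ p k w := fun k w => h2.le.trans (hδ k w).1
  set c : ℝ := δ2 * (1 - δ1) ^ (v - 1) with hc
  have hc0 : 0 < c := mul_pos h2 (pow_pos (sub_pos.2 h1) _)
  have hc1 : c ≤ 1 := mul_le_one₀ (h21.trans h1).le (pow_nonneg (sub_pos.2 h1).le _)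
    (pow_le_one₀ (sub_pos.2 h1).le (by linarith))
  have huniv : S.DeterminedAt 0 Set.univ := fun _ _ _ _ => trivial
  have hgeom : ∀ (n : ℕ) (A : Set S.Ω), S.DeterminedAt n A → ∀ k,
      S.P.real (A ∩ S.future n ⁻¹' noBlock v k) ≤ (1 - c) ^ k * S.P.real A :=
    fun n A hA k => hA.measureReal_noBlock_le hp h1.le h2.le hδ hc1 k
  have hN₀ : S.P {ω | S.hitY0 ω v} ≠ 0 := by
    have hblock := huniv.mul_le_measureReal_block hp h1.le h2.le hδ
    rw [← hc, probReal_univ, mul_one] at hblock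
    refine fun h0 => absurd (hblock.trans (measureReal_mono (s₂ := {ω | S.hitY0 ω v}) ?_)) ?_
    · rintro ω ⟨-, hω⟩
      have := hitY0_add_of_endsPattern (Block.endsPattern hv hω)
      simpa using this
    · rw [Measure.real, h0]
      simpa using hc0
  obtain ⟨Q, hQprob, hQ⟩ := exists_isFutureLaw hp hN₀
  have hQgeom : ∀ k, Q.real (noBlock v k) ≤ (1 - c) ^ k := by
    intro k
    have h := hgeom v _ (determinedAt_hitY0 v) k
    rw [Measure.real, hQ v _ (determinedAt_hitY0 v) (fun ω hω => hω) _
      (measurableSet_noBlock v k), ENNReal.toReal_mul, mul_comm] at h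
    exact le_of_mul_le_mul_right h (ENNReal.toReal_pos hN₀ (measure_ne_top _ _))
  have hr0 : 0 ≤ 1 - c := sub_nonneg.2 hc1
  have hr1 : 1 - c < 1 := sub_lt_self _ hc0
  have hpos := ae_cycleLength_pos hv hr0 hr1 hQgeom
  have hint := integrable_cycleLength hv hr0 hr1 hQgeom
  have hT : ∀ᵐ ω ∂S.P, 0 < S.T 1 ω := by
    have hP : ∀ k, (S.P.map (S.future 0)).real (noBlock v k) ≤ (1 - c) ^ k := by
      intro k
      rw [map_measureReal_apply (S.measurable_future 0) (measurableSet_noBlock v k)]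
      simpa using hgeom 0 _ huniv k
    filter_upwards [ae_of_ae_map (S.measurable_future 0).aemeasurable
      (ae_cycleLength_pos hv hr0 hr1 hP)] with ω hω
    have := hitY0_add_of_endsPattern (endsPattern_cycleLength hω)
    exact T_one_pos (by omega) this
  have hpres := hQ.measurePreserving hT
  have hslln := (hQ.regenerative hpos hN₀).ae_tendsto_ones_div hv hpos hint
  have hcycle : ∀ᵐ ω ∂S.P, S.T 2 ω = S.T 1 ω + cycleLength v (S.futureT ω) := by
    filter_upwards [hT, hpres.quasiMeasurePreserving.ae hpos] with ω h1 h2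
    exact T_two h1 h2
  have hcast : Measurable (fun n : ℕ => (n : ℝ)) := measurable_of_countable _
  have ha : S.a = (∫ u, (cycleOnes v u : ℝ) ∂Q) / ∫ u, (cycleLength v u : ℝ) ∂Q := by
    rw [a, ← hpres.map_eq, integral_map hpres.aemeasurable
        (f := fun u => (cycleOnes v u : ℝ))
        (hcast.comp (measurable_cycleOnes v)).aestronglyMeasurable,
      integral_map hpres.aemeasurable
        (f := fun u => (cycleLength v u : ℝ))
        (hcast.comp (measurable_cycleLength v)).aestronglyMeasurable]
    congr 1
    · refine integral_congr_ae (hcycle.mono fun ω hω => ?_)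
      simp only [zeta, hω, Nat.add_one_sub_one]
      rw [sum_Ioc_eq_ones_future]
      rfl
    · refine integral_congr_ae (hcycle.mono fun ω hω => ?_)
      simp [tau, hω]
  rw [ha]
  filter_upwards [hpres.quasiMeasurePreserving.ae hslln] with ω hω
  simp only [R_eq_ones]
  refine tendsto_ones_div_of_shift (N := S.T 1 ω) (hω.congr fun n => ?_)
  have : S.futureT ω = fun i => S.future 0 ω (S.T 1 ω + i) := by
    funext i
    simp only [futureT, future]
    congr 1
    omega
  rw [this]

end VLMC
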